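/- Let μ and ν be Borel probability measures on ℝ with finite second moments, with CDFs F and G and quantile functions F⁻¹, G⁻¹. Then for every coupling π of μ and ν, ∫_{ℝ×ℝ} (x − y)² dπ(x,y) ≥ ∫₀¹ (F⁻¹(t) − G⁻¹(t))² dt. -/

import Mathlib

open MeasureTheory ProbabilityTheory Set

/-- The cumulative distribution function of a Borel measure on `ℝ`. -/
noncomputable def cdfOf (μ : Measure ℝ) : ℝ → ℝ := fun x => (μ (Iic x)).toReal

/-- The quantile function (generalized inverse) of a CDF `G`:
`G⁻¹ t = inf {x : ℝ | t ≤ G x}`. -/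
noncomputable def quantileFn (G : ℝ → ℝ) : ℝ → ℝ := fun t => sInf {x : ℝ | t ≤ G x}

/-- `π` is a coupling of `μ` and `ν`: its first marginal is `μ` and its second marginal is `ν`. -/
def IsCoupling (π : Measure (ℝ × ℝ)) (μ ν : Measure ℝ) : Prop :=
  π.map Prod.fst = μ ∧ π.map Prod.snd = ν

theorem cdfOf_eq_cdf (μ : Measure ℝ) [IsProbabilityMeasure μ] : cdfOf μ = cdf μ := by
  ext x
  rw [cdf_eq_real]
  rfl

/-- The Galois connection between a CDF and its quantile function. -/
theorem quantileFn_cdfOf_le_iff (μ : Measure ℝ) [IsProbabilityMeasure μ] {t : ℝ}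
    (ht : t ∈ Ioo (0 : ℝ) 1) (a : ℝ) : quantileFn (cdfOf μ) t ≤ a ↔ t ≤ cdfOf μ a := by
  rw [cdfOf_eq_cdf]
  unfold quantileFn
  constructor
  · intro h
    by_contra! hlt
    obtain ⟨x, hxt⟩ := ((tendsto_cdf_atTop μ).eventually_const_le ht.2).exists
    have hright := ((cdf μ).right_continuous a).eventually_lt_const hlt
    obtain ⟨b, hab, hb⟩ := mem_nhdsGE_iff_exists_Ico_subset.1 hright
    refine absurd h (not_le.2 (lt_of_lt_of_le hab (le_csInf ⟨x, hxt⟩ fun y hy ↦ ?_)))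
    by_contra! hyb
    rcases le_total a y with hay | hay
    · exact absurd (show cdf μ y < t from hb ⟨hay, hyb⟩) (not_lt.2 hy)
    · exact absurd (hlt.trans_le hy) (not_lt.2 (monotone_cdf μ hay))
  · intro h
    obtain ⟨x, hx⟩ := ((tendsto_cdf_atBot μ).eventually_lt_const ht.1).exists
    refine csInf_le ⟨x, fun y hy ↦ ?_⟩ h
    by_contra! hyx
    exact absurd (hx.trans_le hy) (not_lt.2 (monotone_cdf μ hyx.le))

theorem monotoneOn_quantileFn_cdfOf (μ : Measure ℝ) [IsProbabilityMeasure μ] :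
    MonotoneOn (quantileFn (cdfOf μ)) (Ioo 0 1) := fun _ hs _ ht hst ↦
  (quantileFn_cdfOf_le_iff μ hs _).2 (hst.trans ((quantileFn_cdfOf_le_iff μ ht _).1 le_rfl))

theorem aemeasurable_quantileFn_cdfOf (μ : Measure ℝ) [IsProbabilityMeasure μ] :
    AEMeasurable (quantileFn (cdfOf μ)) (volume.restrict (Ioo 0 1)) :=
  aemeasurable_restrict_of_monotoneOn measurableSet_Ioo (monotoneOn_quantileFn_cdfOf μ)

/-- Layer-cake formula for the square of the positive part of a difference. -/
theorem lintegral_ofReal_sub_sq_eq {Ω : Type*} [MeasurableSpace Ω] {ρ : Measure Ω} [SFinite ρ]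
    {X Y : Ω → ℝ} (hX : AEMeasurable X ρ) (hY : AEMeasurable Y ρ) :
    ∫⁻ ω, ENNReal.ofReal (Y ω - X ω) ^ 2 ∂ρ =
      ∫⁻ p : ℝ × ℝ, ρ {ω | X ω ≤ min p.1 p.2 ∧ max p.1 p.2 < Y ω} := by
  wlog h : Measurable X ∧ Measurable Y generalizing X Y
  · have key := this hX.measurable_mk.aemeasurable hY.measurable_mk.aemeasurable
      ⟨hX.measurable_mk, hY.measurable_mk⟩
    convert key using 1
    · refine lintegral_congr_ae ?_
      filter_upwards [hX.ae_eq_mk, hY.ae_eq_mk] with ω h₁ h₂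
      rw [h₁, h₂]
    · refine lintegral_congr fun p ↦ measure_congr ?_
      filter_upwards [hX.ae_eq_mk, hY.ae_eq_mk] with ω h₁ h₂
      change (_ ∧ _) = (_ ∧ _)
      rw [h₁, h₂]
  obtain ⟨hX, hY⟩ := h
  let S : Set (Ω × ℝ × ℝ) := {q | X q.1 ≤ min q.2.1 q.2.2 ∧ max q.2.1 q.2.2 < Y q.1}
  have hS : MeasurableSet S :=
    .inter (measurableSet_le (hX.comp measurable_fst) (by fun_prop))
      (measurableSet_lt (by fun_prop) (hY.comp measurable_fst))
  calc ∫⁻ ω, ENNReal.ofReal (Y ω - X ω) ^ 2 ∂ρ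
      = ∫⁻ ω, volume (Prod.mk ω ⁻¹' S) ∂ρ := by
        refine lintegral_congr fun ω ↦ ?_
        have : Prod.mk ω ⁻¹' S = Ico (X ω) (Y ω) ×ˢ Ico (X ω) (Y ω) := by
          ext p
          simp only [S, mem_preimage, mem_ofPred_eq, le_min_iff, max_lt_iff, mem_prod, mem_Ico]
          tauto
        rw [this, Measure.volume_eq_prod, Measure.prod_prod, Real.volume_Ico, sq]
    _ = ρ.prod volume S := (Measure.prod_apply hS).symm
    _ = _ := Measure.prod_apply_symm hS

theorem ofReal_sub_sq_eq_add (x y : ℝ) :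
    ENNReal.ofReal ((x - y) ^ 2) = ENNReal.ofReal (y - x) ^ 2 + ENNReal.ofReal (x - y) ^ 2 := by
  rcases le_total x y with h | h
  · rw [ENNReal.ofReal_of_nonpos (sub_nonpos.2 h), ← ENNReal.ofReal_pow (sub_nonneg.2 h)]
    simp only [ne_eq, OfNat.ofNat_ne_zero, not_false_eq_true, zero_pow, add_zero]
    congr 1
    ring
  · rw [ENNReal.ofReal_of_nonpos (sub_nonpos.2 h), ← ENNReal.ofReal_pow (sub_nonneg.2 h)]
    simp

theorem IsCoupling.swap {π : Measure (ℝ × ℝ)} {μ ν : Measure ℝ} (hπ : IsCoupling π μ ν) :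
    IsCoupling (π.map Prod.swap) ν μ := by
  constructor
  · rw [Measure.map_map measurable_fst measurable_swap]
    exact hπ.2
  · rw [Measure.map_map measurable_snd measurable_swap]
    exact hπ.1

/-- Among all couplings, the quantile coupling gives the least mass to the quadrants
`Iic a ×ˢ Ioi b`. -/
theorem volume_quantileFn_le_measure_coupling {μ ν : Measure ℝ} [IsProbabilityMeasure μ]
    [IsProbabilityMeasure ν] {π : Measure (ℝ × ℝ)} (hπ : IsCoupling π μ ν) (a b : ℝ) :
    volume.restrict (Ioo 0 1) {t | quantileFn (cdfOf μ) t ≤ a ∧ b < quantileFn (cdfOf ν) t} ≤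
      π {p | p.1 ≤ a ∧ b < p.2} := by
  have hμ : π (Prod.fst ⁻¹' Iic a) = μ (Iic a) := by
    rw [← hπ.1, Measure.map_apply measurable_fst measurableSet_Iic]
  have hν : π (Prod.snd ⁻¹' Iic b) = ν (Iic b) := by
    rw [← hπ.2, Measure.map_apply measurable_snd measurableSet_Iic]
  calc volume.restrict (Ioo 0 1)
        {t | quantileFn (cdfOf μ) t ≤ a ∧ b < quantileFn (cdfOf ν) t}
      ≤ volume (Ioc (cdfOf ν b) (cdfOf μ a)) := by
        rw [Measure.restrict_apply' measurableSet_Ioo]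
        refine measure_mono fun t ⟨⟨h₁, h₂⟩, ht⟩ ↦ ?_
        rw [← not_le, quantileFn_cdfOf_le_iff ν ht, not_le] at h₂
        exact ⟨h₂, (quantileFn_cdfOf_le_iff μ ht a).1 h₁⟩
    _ = π (Prod.fst ⁻¹' Iic a) - π (Prod.snd ⁻¹' Iic b) := by
        rw [Real.volume_Ioc, cdfOf, cdfOf, ENNReal.ofReal_sub _ ENNReal.toReal_nonneg,
          ENNReal.ofReal_toReal (measure_ne_top _ _), ENNReal.ofReal_toReal (measure_ne_top _ _),
          hμ, hν]
    _ ≤ π (Prod.fst ⁻¹' Iic a \ Prod.snd ⁻¹' Iic b) := le_measure_sdiff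
    _ = π {p | p.1 ≤ a ∧ b < p.2} := by
        congr 1
        ext p
        simp

theorem lintegral_quantileFn_le_coupling {μ ν : Measure ℝ} [IsProbabilityMeasure μ]
    [IsProbabilityMeasure ν] {π : Measure (ℝ × ℝ)} [SFinite π] (hπ : IsCoupling π μ ν) :
    ∫⁻ t in Ioo 0 1, ENNReal.ofReal (quantileFn (cdfOf ν) t - quantileFn (cdfOf μ) t) ^ 2 ≤
      ∫⁻ p, ENNReal.ofReal (p.2 - p.1) ^ 2 ∂π := by
  rw [lintegral_ofReal_sub_sq_eq (aemeasurable_quantileFn_cdfOf μ)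
      (aemeasurable_quantileFn_cdfOf ν),
    lintegral_ofReal_sub_sq_eq measurable_fst.aemeasurable measurable_snd.aemeasurable]
  exact lintegral_mono fun p ↦ volume_quantileFn_le_measure_coupling hπ _ _

/-- For Borel probability measures `μ, ν` on `ℝ` with finite second moments,
every coupling `π` of `μ` and `ν` satisfies
`∫ (x - y)² dπ ≥ ∫₀¹ (F⁻¹ t - G⁻¹ t)² dt`. -/
theorem coupling_cost_ge_integral_quantile_sq
    (μ ν : Measure ℝ) [IsProbabilityMeasure μ] [IsProbabilityMeasure ν]
    (hμ2 : Integrable (fun x => x ^ 2) μ) (hν2 : Integrable (fun x => x ^ 2) ν)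
    (π : Measure (ℝ × ℝ)) (hπ : IsCoupling π μ ν) :
    ∫ p : ℝ × ℝ, (p.1 - p.2) ^ 2 ∂π ≥
      ∫ t in (0:ℝ)..1, (quantileFn (cdfOf μ) t - quantileFn (cdfOf ν) t) ^ 2 := by
  have : IsProbabilityMeasure π :=
    (Measure.isProbabilityMeasure_map_iff measurable_fst.aemeasurable).1
      (hπ.1 ▸ inferInstance)
  have hfst : Integrable (fun p : ℝ × ℝ ↦ p.1 ^ 2) π := by
    rw [← hπ.1] at hμ2
    exact hμ2.comp_measurable measurable_fst
  have hsnd : Integrable (fun p : ℝ × ℝ ↦ p.2 ^ 2) π := by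
    rw [← hπ.2] at hν2
    exact hν2.comp_measurable measurable_snd
  have hint : Integrable (fun p : ℝ × ℝ ↦ (p.1 - p.2) ^ 2) π := by
    refine ((hfst.add hsnd).const_mul 2).mono' (by fun_prop) (ae_of_all _ fun p ↦ ?_)
    rw [Real.norm_of_nonneg (sq_nonneg _), Pi.add_apply]
    nlinarith [sq_nonneg (p.1 + p.2)]
  have hle : ∫⁻ t in Ioo 0 1,
        ENNReal.ofReal ((quantileFn (cdfOf μ) t - quantileFn (cdfOf ν) t) ^ 2) ≤
      ∫⁻ p, ENNReal.ofReal ((p.1 - p.2) ^ 2) ∂π := by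
    have hswap := lintegral_quantileFn_le_coupling hπ.swap
    rw [lintegral_map (by fun_prop) measurable_swap] at hswap
    simp only [ofReal_sub_sq_eq_add]
    rw [lintegral_add_left' (((aemeasurable_quantileFn_cdfOf ν).fun_sub
        (aemeasurable_quantileFn_cdfOf μ)).ennreal_ofReal.pow_const 2),
      lintegral_add_left (by fun_prop)]
    exact add_le_add (lintegral_quantileFn_le_coupling hπ) hswap
  rw [ge_iff_le, intervalIntegral.integral_of_le zero_le_one, integral_Ioc_eq_integral_Ioo,
    integral_eq_lintegral_of_nonneg_ae (ae_of_all _ fun _ ↦ sq_nonneg _)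
      (((aemeasurable_quantileFn_cdfOf μ).fun_sub
        (aemeasurable_quantileFn_cdfOf ν)).pow_const 2).aestronglyMeasurable,
    integral_eq_lintegral_of_nonneg_ae (ae_of_all _ fun _ ↦ sq_nonneg _)
      hint.aestronglyMeasurable]
  exact ENNReal.toReal_mono hint.lintegral_lt_top.ne hle
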